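/- (Integral comparison via Fubini, core of the proof of Lemma 3.10.) Let T > 0, ε > 0, λ_1 > 0 and 0 ≤ L < λ_1. Let φ, g : [0,T] → [0, ∞) be Lebesgue integrable functions such that for every t ∈ [0,T], φ(t) ≤ (1/ε) ∫_0^t e^{−λ_1 (t − s)/ε} ( g(s) + L φ(s) ) ds. Then ∫_0^T φ(t) dt ≤ ( ∫_0^T g(s) ds ) / (λ_1 − L). -/

import Mathlib

open MeasureTheory Set intervalIntegral

/-- The integral over `(0, T]` of a decaying exponential started at `s` is at most `1 / a`. -/
lemma integral_indicator_exp_decay_le {T a s : ℝ} (ha : 0 < a) (hs : s ∈ Ioc 0 T) :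
    ∫ t in Ioc 0 T, (Ici s).indicator (fun t => Real.exp (-a * (t - s))) t ≤ 1 / a := by
  have hset : Ioc 0 T ∩ Ici s = Icc s T := by
    ext t
    simp only [mem_inter_iff, mem_Ioc, mem_Ici, mem_Icc]
    exact ⟨fun h => ⟨h.2, h.1.2⟩, fun h => ⟨⟨hs.1.trans_le h.1, h.2⟩, h.1⟩⟩
  have hderiv : ∀ t ∈ uIcc s T, HasDerivAt (fun t => -Real.exp (-a * (t - s)) / a)
      (Real.exp (-a * (t - s))) t := by
    intro t _
    have h := ((((hasDerivAt_id t).sub_const s).const_mul (-a)).exp.neg).div_const a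
    exact h.congr_deriv (by simp [ha.ne'])
  rw [setIntegral_indicator measurableSet_Ici, hset, integral_Icc_eq_integral_Ioc,
    ← integral_of_le hs.2, integral_eq_sub_of_hasDerivAt hderiv
      (Continuous.intervalIntegrable (by fun_prop) _ _), ← sub_div]
  gcongr
  simp only [sub_self, mul_zero, Real.exp_zero]
  linarith [Real.exp_pos (-a * (T - s))]

/-- Integrability and `L¹` bound for the convolution of a nonnegative function on `(0, T]` with a
decaying exponential. -/
lemma integrableOn_and_integral_exp_decay_le {T a : ℝ} (ha : 0 < a) {f : ℝ → ℝ}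
    (hf0 : ∀ s ∈ Ioc 0 T, 0 ≤ f s) (hf : IntegrableOn f (Ioc 0 T)) :
    IntegrableOn (fun t => ∫ s in (0 : ℝ)..t, Real.exp (-a * (t - s)) * f s) (Ioc 0 T) ∧
      ∫ t in Ioc 0 T, ∫ s in (0 : ℝ)..t, Real.exp (-a * (t - s)) * f s ≤
        1 / a * ∫ s in Ioc 0 T, f s := by
  let K : ℝ → ℝ → ℝ := fun t s => (Ici s).indicator (fun t => Real.exp (-a * (t - s))) t
  have hKmeas : Measurable (fun p : ℝ × ℝ => K p.1 p.2) := by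
    have hK : (fun p : ℝ × ℝ => K p.1 p.2) =
        {p : ℝ × ℝ | p.2 ≤ p.1}.indicator (fun p => Real.exp (-a * (p.1 - p.2))) := by
      ext p
      simp [K, indicator]
    rw [hK]
    exact Measurable.indicator (by fun_prop) (measurableSet_le measurable_snd measurable_fst)
  have hKbound : ∀ p : ℝ × ℝ, ‖K p.1 p.2‖ ≤ 1 := by
    intro p
    by_cases h : p.2 ≤ p.1
    · simp only [K, indicator, mem_Ici, h, if_true, Real.norm_eq_abs, Real.abs_exp,
        Real.exp_le_one_iff]
      nlinarith
    · simp [K, indicator, h]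
  have hint : Integrable (Function.uncurry fun t s => K t s * f s)
      ((volume.restrict (Ioc 0 T)).prod (volume.restrict (Ioc 0 T))) :=
    (hf.comp_snd (volume.restrict (Ioc 0 T))).bdd_mul hKmeas.aestronglyMeasurable
      (Filter.Eventually.of_forall hKbound)
  have hK : EqOn (fun t => ∫ s in Ioc 0 T, K t s * f s)
      (fun t => ∫ s in (0 : ℝ)..t, Real.exp (-a * (t - s)) * f s) (Ioc 0 T) := by
    intro t ht
    have hset : Ioc 0 t = Ioc 0 T ∩ Iic t := by
      rw [Ioc_inter_Iic, min_eq_right ht.2]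
    simp only
    rw [integral_of_le ht.1.le, hset, ← setIntegral_indicator measurableSet_Iic]
    congr 1
    ext s
    by_cases h : s ≤ t <;> simp [K, indicator, h]
  refine ⟨IntegrableOn.congr_fun hint.integral_prod_left hK measurableSet_Ioc, ?_⟩
  rw [← setIntegral_congr_fun measurableSet_Ioc hK, integral_integral_swap hint,
    ← MeasureTheory.integral_const_mul]
  refine setIntegral_mono_on hint.integral_prod_right (hf.const_mul _) measurableSet_Ioc ?_
  intro s hs
  rw [MeasureTheory.integral_mul_const]
  exact mul_le_mul_of_nonneg_right (integral_indicator_exp_decay_le ha hs) (hf0 s hs)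

open MeasureTheory Set intervalIntegral

/-- (Integral comparison via Fubini, core of the proof of Lemma 3.10.)
If `φ, g : [0,T] → [0,∞)` are integrable and
`φ(t) ≤ (1/ε) ∫_0^t e^{−λ₁(t−s)/ε} (g(s) + L φ(s)) ds` for all `t ∈ [0,T]`, with
`0 ≤ L < λ₁`, then `∫_0^T φ ≤ (∫_0^T g) / (λ₁ − L)`. -/
theorem integral_comparison_fubini
    (T ε l₁ L : ℝ) (hT : 0 < T) (hε : 0 < ε) (hl₁ : 0 < l₁) (hL0 : 0 ≤ L) (hL : L < l₁)
    (φ g : ℝ → ℝ)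
    (hφ0 : ∀ t ∈ Icc (0:ℝ) T, 0 ≤ φ t) (hg0 : ∀ t ∈ Icc (0:ℝ) T, 0 ≤ g t)
    (hφint : IntegrableOn φ (Icc (0:ℝ) T)) (hgint : IntegrableOn g (Icc (0:ℝ) T))
    (hineq : ∀ t ∈ Icc (0:ℝ) T,
      φ t ≤ (1/ε) * ∫ s in (0:ℝ)..t, Real.exp (-l₁ * (t - s) / ε) * (g s + L * φ s)) :
    (∫ t in (0:ℝ)..T, φ t) ≤ (∫ s in (0:ℝ)..T, g s) / (l₁ - L) := by
  have hφ := hφint.mono_set Ioc_subset_Icc_self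
  have hg := hgint.mono_set Ioc_subset_Icc_self
  obtain ⟨hint, hle⟩ := integrableOn_and_integral_exp_decay_le (T := T) (f := fun s => g s + L * φ s)
    (div_pos hl₁ hε)
    (fun s hs => add_nonneg (hg0 s (Ioc_subset_Icc_self hs))
      (mul_nonneg hL0 (hφ0 s (Ioc_subset_Icc_self hs))))
    (hg.add (hφ.const_mul L))
  have hexp : ∀ t s : ℝ, -l₁ * (t - s) / ε = -(l₁ / ε) * (t - s) := fun t s => by ring
  simp only [hexp] at hineq
  have hmono := setIntegral_mono_on hφ (hint.const_mul (1 / ε)) measurableSet_Ioc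
    (fun t ht => hineq t (Ioc_subset_Icc_self ht))
  rw [MeasureTheory.integral_const_mul] at hmono
  rw [MeasureTheory.integral_add hg (hφ.const_mul L),
    MeasureTheory.integral_const_mul] at hle
  rw [integral_of_le hT.le, integral_of_le hT.le, le_div_iff₀ (sub_pos.2 hL)]
  have hbound := hmono.trans (mul_le_mul_of_nonneg_left hle (one_div_pos.2 hε).le)
  have hcoef : ∀ x : ℝ, 1 / ε * (1 / (l₁ / ε) * x) = x / l₁ := fun x => by field_simp
  rw [hcoef, le_div_iff₀ hl₁] at hbound
  linarith
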